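/- Let i, j ∈ ℂ satisfy i² = −1 and j² + j + 1 = 0, and define the five 2-dimensional subspaces of ℂ⁵: π₁ = span{(1,0,0,i,0), (0,1,0,0,i)}, π₂ = span{(1,0,0,−i,0), (0,1,0,0,−i)}, π₃ = span{(0,1,0,1,0), (1,0,1,0,1)}, π₄ = span{(0,1,0,j²,0), (1,0,j²,0,j)}, π₅ = span{(0,1,0,j,0), (1,0,j,0,j²)}. Define the ten vectors of ℂ⁵: e₁₂ = (0,0,1,0,0), e₁₃ = (1,−i,−2,i,1), e₁₄ = (−i,−j²,2ij,1,−ij²), e₁₅ = (−i,−j,2ij²,1,−ij), e₂₃ = (1,i,−2,−i,1), e₂₄ = (i,−j²,−2ij,1,ij²), e₂₅ = (i,−j,−2ij²,1,ij), e₃₄ = (1,0,j²,0,j), e₃₅ = (1,0,j,0,j²), e₄₅ = (1,0,1,0,1). Then for every pair 1 ≤ p < q ≤ 5, the set {v ∈ ℂ⁵ : ∑_k u_k v_k = 0 for all u ∈ π_p ⊔ π_q} is exactly the one-dimensional span of e_{pq}; i.e. e_{pq} spans the common orthogonal of the two planes π_p and π_q with respect to the standard bilinear pairing. -/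

import Mathlib

/-- The five special planes `π₁, …, π₅` of `ℂ⁵` attached to Ozeki's tensor, where
`i² = −1` and `j² + j + 1 = 0`. -/
noncomputable def segrePlanes (i j : ℂ) : Fin 5 → Submodule ℂ (Fin 5 → ℂ) :=
  ![Submodule.span ℂ ({![1, 0, 0, i, 0], ![0, 1, 0, 0, i]} : Set (Fin 5 → ℂ)),
    Submodule.span ℂ ({![1, 0, 0, -i, 0], ![0, 1, 0, 0, -i]} : Set (Fin 5 → ℂ)),
    Submodule.span ℂ ({![0, 1, 0, 1, 0], ![1, 0, 1, 0, 1]} : Set (Fin 5 → ℂ)),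
    Submodule.span ℂ ({![0, 1, 0, j ^ 2, 0], ![1, 0, j ^ 2, 0, j]} : Set (Fin 5 → ℂ)),
    Submodule.span ℂ ({![0, 1, 0, j, 0], ![1, 0, j, 0, j ^ 2]} : Set (Fin 5 → ℂ))]

/-- The ten vectors `e_{pq}` (for `p < q`) spanning the common orthogonals of the pairs
of special planes; the remaining entries of the table are irrelevant. -/
noncomputable def segrePoints (i j : ℂ) : Fin 5 → Fin 5 → (Fin 5 → ℂ) :=
  ![![0, ![0, 0, 1, 0, 0], ![1, -i, -2, i, 1],
      ![-i, -j ^ 2, 2 * i * j, 1, -i * j ^ 2], ![-i, -j, 2 * i * j ^ 2, 1, -i * j]],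
    ![0, 0, ![1, i, -2, -i, 1],
      ![i, -j ^ 2, -2 * i * j, 1, i * j ^ 2], ![i, -j, -2 * i * j ^ 2, 1, i * j]],
    ![0, 0, 0, ![1, 0, j ^ 2, 0, j], ![1, 0, j, 0, j ^ 2]],
    ![0, 0, 0, 0, ![1, 0, 1, 0, 1]],
    ![0, 0, 0, 0, 0]]

/-- Orthogonality to a sup of two spans of pairs reduces to the four generators. -/
lemma orth_sup_span_pair_iff (a b c d v : Fin 5 → ℂ) :
    (∀ u ∈ Submodule.span ℂ ({a, b} : Set (Fin 5 → ℂ)) ⊔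
        Submodule.span ℂ ({c, d} : Set (Fin 5 → ℂ)), (∑ k, u k * v k) = 0) ↔
      ((∑ k, a k * v k) = 0 ∧ (∑ k, b k * v k) = 0) ∧
        ((∑ k, c k * v k) = 0 ∧ (∑ k, d k * v k) = 0) := by
  constructor
  · intro h
    refine ⟨⟨h _ ?_, h _ ?_⟩, ⟨h _ ?_, h _ ?_⟩⟩
    · exact Submodule.mem_sup_left (Submodule.subset_span (by simp))
    · exact Submodule.mem_sup_left (Submodule.subset_span (by simp))
    · exact Submodule.mem_sup_right (Submodule.subset_span (by simp))
    · exact Submodule.mem_sup_right (Submodule.subset_span (by simp))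
  · rintro ⟨⟨ha, hb⟩, hc, hd⟩ u hu
    rw [← Submodule.span_union] at hu
    induction hu using Submodule.span_induction with
    | mem x hx =>
      rcases hx with (rfl | rfl) | (rfl | rfl) <;> assumption
    | zero => simp
    | add x y _ _ hx hy => simp [add_mul, Finset.sum_add_distrib, hx, hy]
    | smul t x _ hx => simp [mul_assoc, ← Finset.mul_sum, hx]

/-- For each `p < q`, the common orthogonal (for the standard bilinear pairing) of the
planes `π_p` and `π_q` is the line spanned by `e_{pq}`. -/
theorem common_orthogonal_of_two_planes (i j : ℂ) (hi : i ^ 2 = -1)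
    (hj : j ^ 2 + j + 1 = 0) (p q : Fin 5) (hpq : p < q) :
    {v : Fin 5 → ℂ |
        ∀ u ∈ segrePlanes i j p ⊔ segrePlanes i j q, (∑ k, u k * v k) = 0} =
      ↑(Submodule.span ℂ ({segrePoints i j p q} : Set (Fin 5 → ℂ))) := by
  have key : ∀ (m : Fin 5) (a b c d e : Fin 5 → ℂ),
      (∀ v : Fin 5 → ℂ, (((∑ k, a k * v k) = 0 ∧ (∑ k, b k * v k) = 0) ∧
        ((∑ k, c k * v k) = 0 ∧ (∑ k, d k * v k) = 0)) → ∀ k, v m * e k = v k) →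
      (((∑ k, a k * e k) = 0 ∧ (∑ k, b k * e k) = 0) ∧
        ((∑ k, c k * e k) = 0 ∧ (∑ k, d k * e k) = 0)) →
      {v : Fin 5 → ℂ | ∀ u ∈ Submodule.span ℂ ({a, b} : Set (Fin 5 → ℂ)) ⊔
        Submodule.span ℂ ({c, d} : Set (Fin 5 → ℂ)), (∑ k, u k * v k) = 0} =
      ↑(Submodule.span ℂ ({e} : Set (Fin 5 → ℂ))) := by
    intro m a b c d e h1 h2
    ext v
    rw [Set.mem_setOf_eq, orth_sup_span_pair_iff, SetLike.mem_coe,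
      Submodule.mem_span_singleton]
    constructor
    · intro h
      exact ⟨v m, funext fun k => by simpa using h1 v h k⟩
    · rintro ⟨t, rfl⟩
      obtain ⟨⟨ha, hb⟩, hc, hd⟩ := h2
      simp only [Pi.smul_apply, smul_eq_mul, mul_left_comm _ t, ← Finset.mul_sum,
        ha, hb, hc, hd, mul_zero, and_self]
  fin_cases p <;> fin_cases q <;> first | exact absurd hpq (by decide) | skip
  · refine key 2 _ _ _ _ _ (fun v hv => ?_) ?_
    · simp [Fin.sum_univ_five] at hv
      obtain ⟨⟨h1, h2⟩, h3, h4⟩ := hv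
      intro k
      fin_cases k <;> simp [segrePoints] <;> grind
    · simp [Fin.sum_univ_five, segrePoints] <;> grind
  · refine key 0 _ _ _ _ _ (fun v hv => ?_) ?_
    · simp [Fin.sum_univ_five] at hv
      obtain ⟨⟨h1, h2⟩, h3, h4⟩ := hv
      intro k
      fin_cases k <;> simp [segrePoints] <;> grind
    · simp [Fin.sum_univ_five, segrePoints] <;> grind
  · refine key 3 _ _ _ _ _ (fun v hv => ?_) ?_
    · simp [Fin.sum_univ_five] at hv
      obtain ⟨⟨h1, h2⟩, h3, h4⟩ := hv
      intro k
      fin_cases k <;> simp [segrePoints] <;> grind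
    · simp [Fin.sum_univ_five, segrePoints] <;> grind
  · refine key 3 _ _ _ _ _ (fun v hv => ?_) ?_
    · simp [Fin.sum_univ_five] at hv
      obtain ⟨⟨h1, h2⟩, h3, h4⟩ := hv
      intro k
      fin_cases k <;> simp [segrePoints] <;> grind
    · simp [Fin.sum_univ_five, segrePoints] <;> grind
  · refine key 0 _ _ _ _ _ (fun v hv => ?_) ?_
    · simp [Fin.sum_univ_five] at hv
      obtain ⟨⟨h1, h2⟩, h3, h4⟩ := hv
      intro k
      fin_cases k <;> simp [segrePoints] <;> grind
    · simp [Fin.sum_univ_five, segrePoints] <;> grind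
  · refine key 3 _ _ _ _ _ (fun v hv => ?_) ?_
    · simp [Fin.sum_univ_five] at hv
      obtain ⟨⟨h1, h2⟩, h3, h4⟩ := hv
      intro k
      fin_cases k <;> simp [segrePoints] <;> grind
    · simp [Fin.sum_univ_five, segrePoints] <;> grind
  · refine key 3 _ _ _ _ _ (fun v hv => ?_) ?_
    · simp [Fin.sum_univ_five] at hv
      obtain ⟨⟨h1, h2⟩, h3, h4⟩ := hv
      intro k
      fin_cases k <;> simp [segrePoints] <;> grind
    · simp [Fin.sum_univ_five, segrePoints] <;> grind
  · refine key 0 _ _ _ _ _ (fun v hv => ?_) ?_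
    · simp [Fin.sum_univ_five] at hv
      obtain ⟨⟨h1, h2⟩, h3, h4⟩ := hv
      intro k
      fin_cases k <;> simp [segrePoints] <;> grind
    · simp [Fin.sum_univ_five, segrePoints] <;> grind
  · refine key 0 _ _ _ _ _ (fun v hv => ?_) ?_
    · simp [Fin.sum_univ_five] at hv
      obtain ⟨⟨h1, h2⟩, h3, h4⟩ := hv
      intro k
      fin_cases k <;> simp [segrePoints] <;> grind
    · simp [Fin.sum_univ_five, segrePoints] <;> grind
  · refine key 0 _ _ _ _ _ (fun v hv => ?_) ?_
    · simp [Fin.sum_univ_five] at hv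
      obtain ⟨⟨h1, h2⟩, h3, h4⟩ := hv
      intro k
      fin_cases k <;> simp [segrePoints] <;> grind
    · simp [Fin.sum_univ_five, segrePoints] <;> grind
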